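/- Let the boundary space ∂𝕏 be finite dimensional. Then the essential spectrum of the coupled operator 𝒜 = (𝔸, 0; 𝔹, 𝔹̃) with domain {(𝕦,𝕩) : 𝕦 ∈ D(𝔸), ℝ𝕦 = 𝕩} equals the essential spectrum of 𝔸₀ = 𝔸|_{ker ℝ}: σ_ess(𝒜) = σ_ess(𝔸₀). Moreover, for μ ∉ σ_ess(𝔸₀), the Fredholm index of 𝒜 − μ equals that of 𝔸₀ − μ. -/

import Mathlib

noncomputable section

/-- The kernel of `μ − T` restricted to the domain `D`. -/
def fredKer {E : Type*} [NormedAddCommGroup E] [NormedSpace ℂ E]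
    (T : E →ₗ[ℂ] E) (D : Submodule ℂ E) (μ : ℂ) : Submodule ℂ E :=
  D ⊓ LinearMap.ker (μ • (LinearMap.id : E →ₗ[ℂ] E) - T)

/-- The range of `μ − T` on the domain `D`. -/
def fredRan {E : Type*} [NormedAddCommGroup E] [NormedSpace ℂ E]
    (T : E →ₗ[ℂ] E) (D : Submodule ℂ E) (μ : ℂ) : Submodule ℂ E :=
  Submodule.map (μ • (LinearMap.id : E →ₗ[ℂ] E) - T) D

/-- `μ − T` (with domain `D`) is a Fredholm operator: finite-dimensional kernel,
closed range of finite codimension.  `μ ∉ σ_ess(T)` means exactly this. -/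
def IsFredholmAt {E : Type*} [NormedAddCommGroup E] [NormedSpace ℂ E]
    (T : E →ₗ[ℂ] E) (D : Submodule ℂ E) (μ : ℂ) : Prop :=
  FiniteDimensional ℂ (fredKer T D μ) ∧
  IsClosed ((fredRan T D μ : Submodule ℂ E) : Set E) ∧
  FiniteDimensional ℂ (E ⧸ fredRan T D μ)

/-- The Fredholm index of `μ − T` with domain `D`. -/
def fredIndexAt {E : Type*} [NormedAddCommGroup E] [NormedSpace ℂ E]
    (T : E →ₗ[ℂ] E) (D : Submodule ℂ E) (μ : ℂ) : ℤ :=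
  (Module.finrank ℂ (fredKer T D μ) : ℤ) - Module.finrank ℂ (E ⧸ fredRan T D μ)

/-- The coupled domain `{(𝕦,𝕩) : 𝕦 ∈ D(𝔸), ℝ𝕦 = 𝕩}` of the operator matrix `𝒜`. -/
def coupledDom {XX bX : Type*} [NormedAddCommGroup XX] [NormedAddCommGroup bX]
    [NormedSpace ℂ XX] [NormedSpace ℂ bX]
    (p : Submodule ℂ XX) (Rop : XX →ₗ[ℂ] bX) : Submodule ℂ (XX × bX) :=
  Submodule.comap (LinearMap.fst ℂ XX bX) p ⊓
    LinearMap.ker (Rop.comp (LinearMap.fst ℂ XX bX) - LinearMap.snd ℂ XX bX)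

/-- The action `(𝕦,𝕩) ↦ (𝔸𝕦, 𝔹𝕦 + 𝔹̃𝕩)` of the operator matrix `𝒜 = (𝔸,0;𝔹,𝔹̃)`. -/
def calAct {XX bX : Type*} [NormedAddCommGroup XX] [NormedAddCommGroup bX]
    [NormedSpace ℂ XX] [NormedSpace ℂ bX]
    (Aop : XX →ₗ[ℂ] XX) (Bop : XX →L[ℂ] bX) (Bt : bX →L[ℂ] bX) :
    (XX × bX) →ₗ[ℂ] (XX × bX) :=
  LinearMap.prod (Aop.comp (LinearMap.fst ℂ XX bX))
    ((Bop : XX →ₗ[ℂ] bX).comp (LinearMap.fst ℂ XX bX) +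
      (Bt : bX →ₗ[ℂ] bX).comp (LinearMap.snd ℂ XX bX))

/-- Algebraic Fredholmness: finite-dimensional kernel and cokernel. -/
def AlgFred {V W : Type*} [AddCommGroup V] [AddCommGroup W] [Module ℂ V] [Module ℂ W]
    (f : V →ₗ[ℂ] W) : Prop :=
  FiniteDimensional ℂ (LinearMap.ker f) ∧ FiniteDimensional ℂ (W ⧸ LinearMap.range f)

lemma finDim_of_ker {V W : Type*} [AddCommGroup V] [AddCommGroup W] [Module ℂ V] [Module ℂ W]
    (f : V →ₗ[ℂ] W) (h1 : FiniteDimensional ℂ (LinearMap.ker f))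
    (h2 : FiniteDimensional ℂ (LinearMap.range f)) : FiniteDimensional ℂ V := by
  refine ⟨Submodule.fg_of_fg_map_of_fg_inf_ker f ?_ ?_⟩
  · rw [Submodule.map_top]
    exact Module.Finite.iff_fg.mp h2
  · rw [top_inf_eq]
    exact Module.Finite.iff_fg.mp h1

section
variable {V W Z : Type*} [AddCommGroup V] [AddCommGroup W] [AddCommGroup Z]
  [Module ℂ V] [Module ℂ W] [Module ℂ Z]

lemma AlgFred.comp {f : V →ₗ[ℂ] W} {g : W →ₗ[ℂ] Z} (hf : AlgFred f) (hg : AlgFred g) :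
    AlgFred (g ∘ₗ f) := by
  obtain ⟨h1, h2⟩ := hf
  obtain ⟨h3, h4⟩ := hg
  constructor
  · rw [LinearMap.ker_comp]; infer_instance
  · rw [LinearMap.range_comp]; infer_instance

lemma AlgFred.index_comp {f : V →ₗ[ℂ] W} {g : W →ₗ[ℂ] Z} (hf : AlgFred f) (hg : AlgFred g) :
    (g ∘ₗ f).index = g.index + f.index := by
  obtain ⟨h1, h2⟩ := hf
  obtain ⟨h3, h4⟩ := hg
  exact LinearMap.index_comp g

lemma AlgFred.of_comp_left {f : V →ₗ[ℂ] W} {g : W →ₗ[ℂ] Z} (hf : AlgFred f)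
    (h : AlgFred (g ∘ₗ f)) : AlgFred g := by
  obtain ⟨h1, h2⟩ := hf
  obtain ⟨h3, h4⟩ := h
  constructor
  · refine Module.Finite.iff_fg.mpr
      (Submodule.fg_of_fg_map_of_fg_inf_ker (LinearMap.range f).mkQ ?_ ?_)
    · exact IsNoetherian.noetherian _
    · rw [Submodule.ker_mkQ]
      have : LinearMap.ker g ⊓ LinearMap.range f = (LinearMap.ker (g ∘ₗ f)).map f := by
        rw [LinearMap.ker_comp, Submodule.map_comap_eq, inf_comm]
      rw [this]
      exact (Module.Finite.iff_fg.mp h3).map f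
  · exact Module.Finite.of_surjective
      (Submodule.factor (LinearMap.range_comp_le_range f g)) (Submodule.factor_surjective _)

lemma AlgFred.of_comp_right {f : V →ₗ[ℂ] W} {g : W →ₗ[ℂ] Z} (hg : AlgFred g)
    (h : AlgFred (g ∘ₗ f)) : AlgFred f := by
  obtain ⟨h1, h2⟩ := hg
  obtain ⟨h3, h4⟩ := h
  constructor
  · exact Submodule.finiteDimensional_of_le (LinearMap.ker_le_ker_comp f g)
  · have aux : LinearMap.range f ≤ Submodule.comap g (LinearMap.range (g ∘ₗ f)) := by
      rw [← Submodule.map_le_iff_le_comap, LinearMap.range_comp]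
    refine finDim_of_ker ((LinearMap.range f).mapQ (LinearMap.range (g ∘ₗ f)) g aux) ?_ ?_
    · rw [Submodule.ker_mapQ, LinearMap.range_comp, Submodule.comap_map_eq, Submodule.map_sup]
      rw [Submodule.mkQ_map_self, bot_sup_eq]
      infer_instance
    · infer_instance
end

/-- A bounded operator between Banach spaces whose range has finite codimension
has closed range. -/
lemma isClosed_range_of_finCoker {E F : Type*} [NormedAddCommGroup E] [NormedAddCommGroup F]
    [NormedSpace ℂ E] [NormedSpace ℂ F] [CompleteSpace E] [CompleteSpace F]
    (f : E →L[ℂ] F) (h : FiniteDimensional ℂ (F ⧸ LinearMap.range (f : E →ₗ[ℂ] F))) :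
    IsClosed ((LinearMap.range (f : E →ₗ[ℂ] F) : Submodule ℂ F) : Set F) := by
  obtain ⟨G, hG⟩ := Submodule.exists_isCompl (LinearMap.range (f : E →ₗ[ℂ] F))
  have : FiniteDimensional ℂ G := (Submodule.quotientEquivOfIsCompl _ _ hG).finiteDimensional
  have : CompleteSpace G := FiniteDimensional.complete ℂ G
  let k : (E × G) →L[ℂ] F := f.coprod G.subtypeL
  have hk : ∀ e g, k (e, g) = f e + g := fun e g => by simp [k]
  have hsurj : Function.Surjective k := by
    intro y
    have hy : y ∈ LinearMap.range (f : E →ₗ[ℂ] F) ⊔ G := by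
      rw [hG.sup_eq_top]; trivial
    obtain ⟨a, ⟨e, rfl⟩, b, hb, rfl⟩ := Submodule.mem_sup.mp hy
    exact ⟨(e, ⟨b, hb⟩), by rw [hk]; rfl⟩
  have hopen := k.isOpenMap hsurj
  rw [← isOpen_compl_iff]
  have hU : IsOpen {q : E × G | q.2 ≠ 0} :=
    isOpen_ne_fun continuous_snd continuous_const
  convert hopen _ hU using 1
  ext y
  constructor
  · intro hy
    obtain ⟨⟨e, g⟩, rfl⟩ := hsurj y
    refine ⟨(e, g), ?_, rfl⟩
    intro h0
    apply hy
    have h0 : g = 0 := h0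
    subst h0
    exact ⟨e, by rw [hk]; simp⟩
  · rintro ⟨⟨e, g⟩, hg, rfl⟩ ⟨e', he'⟩
    apply hg
    have h1 : (g : F) ∈ LinearMap.range (f : E →ₗ[ℂ] F) := by
      refine ⟨e' - e, ?_⟩
      rw [map_sub, he', hk]
      simp
    have h2 := Submodule.disjoint_def.mp hG.disjoint _ h1 g.2
    exact Subtype.ext h2

/-- Passing from an unbounded operator to a bounded one by parametrizing its domain. -/
lemma fredholm_param {E : Type*} [NormedAddCommGroup E] [NormedSpace ℂ E] [CompleteSpace E]
    (T : E →ₗ[ℂ] E) (D : Submodule ℂ E) (μ : ℂ) (J : E →ₗ[ℂ] E)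
    (hJ : Function.Injective J) (hJD : LinearMap.range J = D) (K : E →L[ℂ] E)
    (hK : ∀ x, K x = μ • J x - T (J x)) :
    (IsFredholmAt T D μ ↔ AlgFred (K : E →ₗ[ℂ] E)) ∧
      fredIndexAt T D μ = (K : E →ₗ[ℂ] E).index := by
  have hcomp : (K : E →ₗ[ℂ] E) = (μ • (LinearMap.id : E →ₗ[ℂ] E) - T) ∘ₗ J := by
    ext x; simp [hK]
  have hran : fredRan T D μ = LinearMap.range (K : E →ₗ[ℂ] E) := by
    rw [fredRan, hcomp, LinearMap.range_comp, hJD]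
  have hker : fredKer T D μ = (LinearMap.ker (K : E →ₗ[ℂ] E)).map J := by
    rw [fredKer, hcomp, LinearMap.ker_comp, Submodule.map_comap_eq, hJD]
  have e : LinearMap.ker (K : E →ₗ[ℂ] E) ≃ₗ[ℂ] fredKer T D μ := by
    rw [hker]; exact Submodule.equivMapOfInjective J hJ _
  constructor
  · unfold IsFredholmAt AlgFred
    rw [hran]
    constructor
    · rintro ⟨h1, -, h3⟩
      exact ⟨e.symm.finiteDimensional, h3⟩
    · rintro ⟨h1, h3⟩
      exact ⟨e.finiteDimensional, isClosed_range_of_finCoker K h3, h3⟩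
  · rw [fredIndexAt, LinearMap.index_eq_finrank_sub, hran, e.finrank_eq]

lemma algFred_inl (X Y : Type*) [AddCommGroup X] [AddCommGroup Y] [Module ℂ X] [Module ℂ Y]
    [FiniteDimensional ℂ Y] : AlgFred (LinearMap.inl ℂ X Y) := by
  constructor
  · rw [LinearMap.ker_eq_bot.mpr LinearMap.inl_injective]; infer_instance
  · rw [LinearMap.range_inl]
    exact ((LinearMap.snd ℂ X Y).quotKerEquivRange).symm.finiteDimensional

lemma algFred_fst (X Y : Type*) [AddCommGroup X] [AddCommGroup Y] [Module ℂ X] [Module ℂ Y]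
    [FiniteDimensional ℂ Y] : AlgFred (LinearMap.fst ℂ X Y) := by
  constructor
  · rw [LinearMap.ker_fst]; infer_instance
  · rw [LinearMap.range_eq_top.mpr LinearMap.fst_surjective]; infer_instance

/-- If `K₀` is the upper left corner of `K`, and the second factor is finite dimensional,
then `K` and `K₀` are simultaneously Fredholm, of the same index. -/
lemma algFred_corner {X Y : Type*} [AddCommGroup X] [AddCommGroup Y] [Module ℂ X] [Module ℂ Y]
    [FiniteDimensional ℂ Y] (K : (X × Y) →ₗ[ℂ] (X × Y)) (K0 : X →ₗ[ℂ] X)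
    (h : K0 = LinearMap.fst ℂ X Y ∘ₗ (K ∘ₗ LinearMap.inl ℂ X Y)) :
    (AlgFred K ↔ AlgFred K0) ∧ (AlgFred K0 → K.index = K0.index) := by
  have hi := algFred_inl X Y
  have hf := algFred_fst X Y
  have h1 : AlgFred K ↔ AlgFred K0 := by
    rw [h]
    exact ⟨fun hK => (hi.comp hK).comp hf,
      fun h0 => AlgFred.of_comp_left hi (AlgFred.of_comp_right hf h0)⟩
  refine ⟨h1, fun h0 => ?_⟩
  have hK := h1.mpr h0
  have hid : (LinearMap.fst ℂ X Y ∘ₗ LinearMap.inl ℂ X Y).index = 0 := by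
    rw [LinearMap.fst_comp_inl, LinearMap.index_id]
  rw [hi.index_comp hf] at hid
  rw [h, (hi.comp hK).index_comp hf, hi.index_comp hK]
  linarith

/-- Proposition 3.14: if `∂𝕏` is finite dimensional then `σ_ess(𝒜) = σ_ess(𝔸₀)`, and
`ind(𝒜 − μ) = ind(𝔸₀ − μ)` for all `μ ∉ σ_ess(𝔸₀)`. -/
theorem stmt15 {XX bX : Type*} [NormedAddCommGroup XX] [NormedAddCommGroup bX]
    [NormedSpace ℂ XX] [NormedSpace ℂ bX] [CompleteSpace XX] [CompleteSpace bX]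
    [FiniteDimensional ℂ bX]
    (p : Submodule ℂ XX) (Aop : XX →ₗ[ℂ] XX) (Rop : XX →ₗ[ℂ] bX)
    (hRsurj : ∀ x : bX, ∃ u, u ∈ p ∧ Rop u = x)
    (Bop : XX →L[ℂ] bX) (Bt : bX →L[ℂ] bX) (lam : ℂ)
    -- `lam ∈ ρ(𝔸₀)` with bounded resolvent, and the associated Dirichlet operator
    (Rres : XX →L[ℂ] XX)
    (hR1 : ∀ w : XX, Rres w ∈ p ∧ Rop (Rres w) = 0 ∧ lam • Rres w - Aop (Rres w) = w)
    (hR2 : ∀ u ∈ p, Rop u = 0 → Rres (lam • u - Aop u) = u)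
    (Dlam : bX →L[ℂ] XX)
    (hD1 : ∀ x : bX, Dlam x ∈ p ∧ Aop (Dlam x) = lam • Dlam x ∧ Rop (Dlam x) = x)
    (hD2 : ∀ u ∈ p, Aop u = lam • u → Dlam (Rop u) = u) :
    ∀ μ : ℂ,
      (IsFredholmAt (calAct Aop Bop Bt) (coupledDom p Rop) μ ↔
        IsFredholmAt Aop (p ⊓ LinearMap.ker Rop) μ) ∧
      (IsFredholmAt Aop (p ⊓ LinearMap.ker Rop) μ →
        fredIndexAt (calAct Aop Bop Bt) (coupledDom p Rop) μ =
          fredIndexAt Aop (p ⊓ LinearMap.ker Rop) μ) := by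
  intro μ
  let K0 : XX →L[ℂ] XX := ContinuousLinearMap.id ℂ XX + (μ - lam) • Rres
  let J : (XX × bX) →ₗ[ℂ] (XX × bX) :=
    LinearMap.prod ((Rres : XX →ₗ[ℂ] XX).coprod (Dlam : bX →ₗ[ℂ] XX)) (LinearMap.snd ℂ XX bX)
  let U : (XX × bX) →L[ℂ] XX := Rres.coprod Dlam
  let P2 : (XX × bX) →L[ℂ] bX := ContinuousLinearMap.snd ℂ XX bX
  let K : (XX × bX) →L[ℂ] (XX × bX) :=
    (ContinuousLinearMap.fst ℂ XX bX + (μ - lam) • U).prod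
      (μ • P2 - (Bop.comp U + Bt.comp P2))
  have hRinj : Function.Injective Rres := by
    rw [injective_iff_map_eq_zero]
    intro w hw
    have := (hR1 w).2.2
    rw [hw] at this
    simpa using this.symm
  have hAR : ∀ w, Aop (Rres w) = lam • Rres w - w := fun w => by
    have h := (hR1 w).2.2
    nth_rewrite 3 [← h]
    abel
  have hp0 := fredholm_param Aop (p ⊓ LinearMap.ker Rop) μ (Rres : XX →ₗ[ℂ] XX) hRinj
    (by
      ext u
      constructor
      · rintro ⟨w, rfl⟩
        exact ⟨(hR1 w).1, (hR1 w).2.1⟩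
      · rintro ⟨hu, hu0⟩
        exact ⟨_, hR2 u hu hu0⟩) K0
    (by
      intro w
      simp only [K0, ContinuousLinearMap.coe_coe, hAR, ContinuousLinearMap.add_apply,
        ContinuousLinearMap.smul_apply, ContinuousLinearMap.id_apply]
      module)
  have hp1 := fredholm_param (calAct Aop Bop Bt) (coupledDom p Rop) μ J
    (by
      rw [injective_iff_map_eq_zero]
      rintro ⟨w, x⟩ h
      have hx : x = 0 := congrArg Prod.snd h
      have hw : Rres w + Dlam x = 0 := congrArg Prod.fst h
      subst hx
      rw [map_zero, add_zero] at hw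
      have : w = 0 := hRinj (by rw [hw, map_zero])
      rw [this]; rfl)
    (by
      ext ⟨u, x⟩
      constructor
      · rintro ⟨⟨w, y⟩, h⟩
        have hx : y = x := congrArg Prod.snd h
        have hw : Rres w + Dlam y = u := congrArg Prod.fst h
        subst hx hw
        refine ⟨p.add_mem (hR1 w).1 (hD1 y).1, ?_⟩
        change Rop (Rres w + Dlam y) - y = 0
        rw [map_add, (hR1 w).2.1, (hD1 y).2.2, zero_add, sub_self]
      · rintro ⟨hu, hx⟩
        have hu : u ∈ p := hu
        have hx : Rop u - x = 0 := hx
        refine ⟨(lam • u - Aop u, x), ?_⟩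
        have key := hR2 (u - Dlam x) (p.sub_mem hu (hD1 x).1)
          (by rw [map_sub, (hD1 x).2.2, hx])
        have e1 : lam • (u - Dlam x) - Aop (u - Dlam x) = lam • u - Aop u := by
          rw [map_sub, (hD1 x).2.1]; module
        rw [e1] at key
        change (Rres (lam • u - Aop u) + Dlam x, x) = (u, x)
        rw [key, sub_add_cancel]) K
    (by
      rintro ⟨w, x⟩
      change (w + (μ - lam) • (Rres.coprod Dlam) (w, x),
          μ • x - (Bop ((Rres.coprod Dlam) (w, x)) + Bt x)) =
        μ • (Rres w + Dlam x, x) - (Aop (Rres w + Dlam x), Bop (Rres w + Dlam x) + Bt x)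
      rw [ContinuousLinearMap.coprod_apply, map_add Aop, hAR, (hD1 x).2.1]
      refine Prod.ext ?_ ?_
      · simp only [Prod.fst_sub, Prod.smul_fst]; module
      · simp only [Prod.snd_sub, Prod.smul_snd])
  have hc := algFred_corner (K : (XX × bX) →ₗ[ℂ] (XX × bX)) (K0 : XX →ₗ[ℂ] XX)
    (by
      ext w
      change w + (μ - lam) • Rres w = w + (μ - lam) • (Rres.coprod Dlam) (w, 0)
      rw [ContinuousLinearMap.coprod_apply, map_zero, add_zero])
  rw [hp0.1, hp1.1, hp0.2, hp1.2]
  exact hc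

end
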